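/- Let A be a 2×2 real matrix with det A = 1 and |t| > 2 where t := trace A, and set λ := (|t| + √(t² − 4))/2 > 1. Then the sequence |det(I − Aⁿ)|^{1/n} converges to λ as n → ∞; that is, the growth rate of the sequence |det(I − Aⁿ)| equals λ, the spectral radius of A. -/

import Mathlib

open Filter

lemma trace_pow_aux (A : Matrix (Fin 2) (Fin 2) ℝ) (hdet : A.det = 1) (μ ν : ℝ)
    (h1 : μ * ν = 1) (h2 : μ + ν = A.trace) (n : ℕ) :
    (A ^ n).trace = μ ^ n + ν ^ n := by
  have hA : A * A = A.trace • A - 1 := by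
    rw [Matrix.det_fin_two] at hdet
    ext i j
    fin_cases i <;> fin_cases j <;>
      simp [Matrix.mul_apply, Fin.sum_univ_two, Matrix.trace_fin_two] <;> linarith
  induction n using Nat.twoStepInduction with
  | zero => simp [Matrix.trace_fin_two]; norm_num
  | one => simp [h2]
  | more n ih1 ih2 =>
    have : A ^ (n + 2) = A.trace • A ^ (n + 1) - A ^ n := by
      rw [pow_add, pow_two, hA, mul_sub, mul_one, Matrix.mul_smul, ← pow_succ]
    rw [this, Matrix.trace_sub, Matrix.trace_smul, ih1, ih2, ← h2, smul_eq_mul]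
    linear_combination (μ ^ n + ν ^ n) * h1

theorem growth_rate_det_one_sub_pow_of_hyperbolic (A : Matrix (Fin 2) (Fin 2) ℝ)
    (hdet : A.det = 1) (htr : 2 < |A.trace|)
    (lam : ℝ) (hlam : lam = (|A.trace| + Real.sqrt (A.trace ^ 2 - 4)) / 2) :
    Tendsto (fun n : ℕ => |(1 - A ^ n).det| ^ (1 / (n : ℝ))) atTop (nhds lam) := by
  have hsq : (0 : ℝ) ≤ A.trace ^ 2 - 4 := by
    rw [← sq_abs]; nlinarith
  have hs := Real.sq_sqrt hsq
  have hs0 := Real.sqrt_nonneg (A.trace ^ 2 - 4)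
  have hl1 : 1 < lam := by rw [hlam]; linarith
  have hq : lam * (|A.trace| - lam) = 1 := by
    have := sq_abs A.trace
    rw [hlam]; nlinarith
  obtain ⟨μ, ν, h1, h2, hμ⟩ : ∃ μ ν : ℝ, μ * ν = 1 ∧ μ + ν = A.trace ∧ |μ| = lam := by
    rcases abs_cases A.trace with ⟨h, _⟩ | ⟨h, _⟩
    · exact ⟨lam, A.trace - lam, by rw [← h]; exact hq, by ring, abs_of_pos (by linarith)⟩
    · refine ⟨-lam, A.trace + lam, ?_, by ring, by rw [abs_neg]; exact abs_of_pos (by linarith)⟩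
      rw [h] at hq; linarith
  have hν : |ν| < 1 := by
    have : lam * |ν| = 1 := by rw [← hμ, ← abs_mul, h1, abs_one]
    nlinarith [abs_nonneg ν]
  have hD : ∀ n : ℕ, |(1 - A ^ n).det| = lam ^ n * (1 - ν ^ n) ^ 2 := by
    intro n
    have e1 : (1 - A ^ n).det = 1 - (A ^ n).trace + (A ^ n).det := by
      generalize A ^ n = B
      simp [Matrix.det_fin_two, Matrix.trace_fin_two]; ring
    have e2 : μ ^ n * ν ^ n = 1 := by rw [← mul_pow, h1, one_pow]
    have e3 : (1 - A ^ n).det = -(μ ^ n * (1 - ν ^ n) ^ 2) := by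
      rw [e1, trace_pow_aux A hdet μ ν h1 h2, Matrix.det_pow, hdet, one_pow]
      linear_combination (ν ^ n - 2) * e2
    rw [e3, abs_neg, abs_mul, abs_pow, hμ, abs_of_nonneg (sq_nonneg (1 - ν ^ n))]
  have hlim : Tendsto (fun n : ℕ => lam * ((1 - ν ^ n) ^ 2) ^ (1 / (n : ℝ))) atTop
      (nhds (lam * ((1 - 0) ^ 2) ^ (0 : ℝ))) := by
    refine Tendsto.const_mul _ (Tendsto.rpow ?_ tendsto_one_div_atTop_nhds_zero_nat ?_)
    · exact ((tendsto_pow_atTop_nhds_zero_of_abs_lt_one hν).const_sub 1).pow 2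
    · left; norm_num
  rw [Real.rpow_zero, mul_one] at hlim
  refine hlim.congr' ?_
  filter_upwards [eventually_ne_atTop 0] with n hn
  have hl0 : 0 ≤ lam := by linarith
  rw [hD, Real.mul_rpow (pow_nonneg hl0 n) (sq_nonneg _), one_div,
    Real.pow_rpow_inv_natCast hl0 hn]
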